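/- For every n ≥ 1, the set of unit vectors of ℝ⁴ lying in 2⁻ⁿℤ[τ]⁴ equals the union ⋃_{m ≤ n} (𝒮ₘ ∪ 𝒮ₘ'). Moreover, a unit vector x ∈ 2⁻ⁿℤ[τ]⁴ lies in 𝒮ₙ ∪ 𝒮ₙ' if and only if the image of 2ⁿx in 𝔽₄⁴ is not (0̄,0̄,0̄,0̄). -/

import Mathlib

noncomputable section

/-- The golden ratio τ = (1+√5)/2. -/
def gr : ℝ := (1 + Real.sqrt 5) / 2

/-- The ring ℤ[τ] as a subset of ℝ. -/
def Ztau : Set ℝ := {x : ℝ | ∃ a b : ℤ, x = (a : ℝ) + (b : ℝ) * gr}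

/-- Congruence modulo 2ℤ[τ]. -/
def cong2 (x y : ℝ) : Prop := ∃ a b : ℤ, x - y = 2 * ((a : ℝ) + (b : ℝ) * gr)

/-- The vector (0, 1, τ', τ) (for t = τ; its conjugate for t = τ'). -/
def v4 (t : ℝ) : Fin 4 → ℝ := ![0, 1, 1 - t, t]

/-- Representatives of the four classes of 𝔽₄ = ℤ[τ]/2ℤ[τ]. -/
def Reps : Set ℝ := {0, 1, gr, 1 + gr}

/-- `y` reduces mod 2ℤ[τ]⁴ into the 𝔽₄-span A of (1,1,1,1) and (0,1,τ',τ). -/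
def inAmod (t : ℝ) (y : Fin 4 → ℝ) : Prop :=
  ∃ c ∈ Reps, ∃ d ∈ Reps, ∀ i, cong2 (y i) (c + d * v4 t i)

/-- `y` reduces mod 2ℤ[τ]⁴ into Ȧ, the images of even permutations of (0,1,τ',τ). -/
def inAdot (t : ℝ) (y : Fin 4 → ℝ) : Prop :=
  ∃ σ : Equiv.Perm (Fin 4), Equiv.Perm.sign σ = 1 ∧ ∀ i, cong2 (y i) (v4 t (σ i))

/-- The spherical sets 𝒮ₙ (t = τ) resp. 𝒮ₙ' (t = τ'). -/
def sphS (t : ℝ) : ℕ → Set (Fin 4 → ℝ)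
  | 0 => {x | ∃ i, (x i = 1 ∨ x i = -1) ∧ ∀ j, j ≠ i → x j = 0}
  | (n+1) => {x | (∑ i, x i ^ 2) = 1 ∧ (∀ i, 2 ^ (n+1) * x i ∈ Ztau) ∧
      inAmod t (fun i => 2 ^ (n+1) * x i) ∧ ∃ i, ¬ cong2 (2 ^ (n+1) * x i) 0}

/-- The spherical sets 𝒮̇ₙ (t = τ) resp. 𝒮̇ₙ' (t = τ'). -/
def sphSdot (t : ℝ) (n : ℕ) : Set (Fin 4 → ℝ) :=
  {x | (∑ i, x i ^ 2) = 1 ∧ (∀ i, 2 ^ n * x i ∈ Ztau) ∧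
    inAdot t (fun i => 2 ^ n * x i)}

lemma gr_sq : gr ^ 2 = gr + 1 := Real.goldenRatio_sq

lemma Ztau_add {x y : ℝ} (hx : x ∈ Ztau) (hy : y ∈ Ztau) : x + y ∈ Ztau := by
  obtain ⟨a, b, rfl⟩ := hx
  obtain ⟨c, d, rfl⟩ := hy
  exact ⟨a + c, b + d, by push_cast; ring⟩

lemma Ztau_mul {x y : ℝ} (hx : x ∈ Ztau) (hy : y ∈ Ztau) : x * y ∈ Ztau := by
  obtain ⟨a, b, rfl⟩ := hx
  obtain ⟨c, d, rfl⟩ := hy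
  refine ⟨a * c + b * d, a * d + b * c + b * d, ?_⟩
  push_cast
  linear_combination (b * d : ℝ) * gr_sq

lemma Ztau_intCast (k : ℤ) : (k : ℝ) ∈ Ztau := ⟨k, 0, by simp⟩

lemma Ztau_sub {x y : ℝ} (hx : x ∈ Ztau) (hy : y ∈ Ztau) : x - y ∈ Ztau := by
  have h := Ztau_add hx (Ztau_mul (Ztau_intCast (-1)) hy)
  convert h using 1
  push_cast
  ring

lemma gr_mem_Ztau : gr ∈ Ztau := ⟨0, 1, by simp⟩

lemma one_mem_Ztau : (1 : ℝ) ∈ Ztau := ⟨1, 0, by simp⟩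

lemma conj_gr_mem_Ztau : 1 - gr ∈ Ztau := Ztau_sub one_mem_Ztau gr_mem_Ztau

lemma two_pow_mem_Ztau (k : ℕ) : (2 : ℝ) ^ k ∈ Ztau := by
  simpa using Ztau_intCast (2 ^ k)

lemma cong2_iff {x y : ℝ} : cong2 x y ↔ ∃ z ∈ Ztau, x - y = 2 * z := by
  constructor
  · rintro ⟨a, b, h⟩
    exact ⟨_, ⟨a, b, rfl⟩, h⟩
  · rintro ⟨_, ⟨a, b, rfl⟩, h⟩
    exact ⟨a, b, h⟩

/-- `1` and `τ` are linearly independent over `ℤ`. -/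
lemma intCast_add_mul_gr_inj {a b c d : ℤ} (h : (a : ℝ) + b * gr = c + d * gr) :
    a = c ∧ b = d := by
  have hirr : Irrational gr := Real.goldenRatio_irrational
  have hbd : b = d := by
    by_contra hne
    refine (hirr.intCast_mul (sub_ne_zero.mpr hne)).ne_int (c - a) ?_
    push_cast
    linear_combination h
  subst hbd
  exact ⟨by exact_mod_cast add_right_cancel h, rfl⟩

lemma exists_Reps_of_mem_Ztau {x : ℝ} (hx : x ∈ Ztau) :
    ∃ c ∈ Reps, ∃ z ∈ Ztau, x = c + 2 * z := by
  obtain ⟨a, b, rfl⟩ := hx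
  refine ⟨((a % 2 : ℤ) : ℝ) + ((b % 2 : ℤ) : ℝ) * gr, ?_, _, ⟨a / 2, b / 2, rfl⟩, ?_⟩
  · rcases Int.emod_two_eq_zero_or_one a with ha | ha <;>
      rcases Int.emod_two_eq_zero_or_one b with hb | hb <;> simp [ha, hb, Reps]
  · have ha : (a : ℝ) = (a % 2 : ℤ) + 2 * (a / 2 : ℤ) := by
      exact_mod_cast (Int.emod_add_mul_ediv a 2).symm
    have hb : (b : ℝ) = (b % 2 : ℤ) + 2 * (b / 2 : ℤ) := by
      exact_mod_cast (Int.emod_add_mul_ediv b 2).symm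
    linear_combination ha + gr * hb

lemma v4_mem_Ztau {t : ℝ} (ht : t ∈ Ztau) (i : Fin 4) : v4 t i ∈ Ztau := by
  fin_cases i
  · exact ⟨0, 0, by simp [v4]⟩
  · exact one_mem_Ztau
  · exact Ztau_sub one_mem_Ztau ht
  · exact ht

/-- A vector of `A` is determined by its first two coordinates. -/
lemma inAmod_of_cong2 {t : ℝ} (ht : t ∈ Ztau) {y : Fin 4 → ℝ} (hy : ∀ i, y i ∈ Ztau)
    (h2 : cong2 (y 2) (y 0 + (y 1 - y 0) * (1 - t)))
    (h3 : cong2 (y 3) (y 0 + (y 1 - y 0) * t)) : inAmod t y := by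
  obtain ⟨c, hc, u, hu, hcu⟩ := exists_Reps_of_mem_Ztau (hy 0)
  obtain ⟨d, hd, w, hw, hdw⟩ := exists_Reps_of_mem_Ztau (Ztau_sub (hy 1) (hy 0))
  have key : ∀ i, cong2 (y i) (y 0 + (y 1 - y 0) * v4 t i) := by
    intro i
    fin_cases i
    · exact ⟨0, 0, by simp [v4]⟩
    · exact ⟨0, 0, by simp [v4]⟩
    · exact h2
    · exact h3
  refine ⟨c, hc, d, hd, fun i => ?_⟩
  obtain ⟨z, hz, hzi⟩ := cong2_iff.mp (key i)
  refine cong2_iff.mpr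
    ⟨z + (u + w * v4 t i), Ztau_add hz (Ztau_add hu (Ztau_mul hw (v4_mem_Ztau ht i))), ?_⟩
  linear_combination hzi + hcu + v4 t i * hdw

lemma sum_sq_eq_intCast_iff {a b : Fin 4 → ℤ} {N : ℤ} :
    ∑ i, ((a i : ℝ) + b i * gr) ^ 2 = N ↔
      ∑ i, (a i ^ 2 + b i ^ 2) = N ∧ ∑ i, (2 * (a i * b i) + b i ^ 2) = 0 := by
  have hsum : ∑ i, ((a i : ℝ) + b i * gr) ^ 2 =
      ((∑ i, (a i ^ 2 + b i ^ 2) : ℤ) : ℝ) +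
        ((∑ i, (2 * (a i * b i) + b i ^ 2) : ℤ) : ℝ) * gr := by
    push_cast
    rw [Finset.sum_mul, ← Finset.sum_add_distrib]
    refine Finset.sum_congr rfl fun i _ => ?_
    linear_combination (b i : ℝ) ^ 2 * gr_sq
  rw [hsum]
  constructor
  · intro h
    exact intCast_add_mul_gr_inj (d := 0) (by simpa using h)
  · rintro ⟨h1, h2⟩
    rw [h1, h2]
    simp

/-- The parity patterns of the coordinates `aᵢ + bᵢτ` of a vector with squared norm divisible
by `4`: they form the union of the two codes `A` and `A'`. -/
lemma parity_pattern : ∀ p₀ p₁ p₂ p₃ q₀ q₁ q₂ q₃ : Fin 2,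
    ((p₀ : ℕ) + p₁ + p₂ + p₃ + q₀ + q₁ + q₂ + q₃) % 4 = 0 →
    (2 * ((p₀ : ℕ) * q₀ + p₁ * q₁ + p₂ * q₂ + p₃ * q₃) + q₀ + q₁ + q₂ + q₃) % 4 = 0 →
    (p₂ = p₁ + q₁ + q₀ ∧ q₂ = q₀ + p₁ + p₀ ∧ p₃ = p₀ + q₀ + q₁ ∧ q₃ = p₀ + p₁ + q₁) ∨
    (p₃ = p₁ + q₁ + q₀ ∧ q₃ = q₀ + p₁ + p₀ ∧ p₂ = p₀ + q₀ + q₁ ∧ q₂ = p₀ + p₁ + q₁) := by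
  decide

lemma exists_eq_two_mul_add_fin (a : ℤ) : ∃ (k : ℤ) (p : Fin 2), a = 2 * k + (p : ℕ) := by
  rcases Int.emod_two_eq_zero_or_one a with h | h
  · exact ⟨a / 2, 0, by simp; omega⟩
  · exact ⟨a / 2, 1, by simp; omega⟩

lemma fin_two_natCast_sq (p : Fin 2) : ((p : ℕ) : ℤ) ^ 2 = (p : ℕ) := by
  fin_cases p <;> simp

lemma exists_eq_add_two_mul_of_fin_eq {p q r s : Fin 2} (h : p = q + r + s) :
    ∃ m : ℤ, ((p : ℕ) : ℤ) = (q : ℕ) + (r : ℕ) + (s : ℕ) + 2 * m := by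
  have h' := congrArg Fin.val h
  simp only [Fin.val_add] at h'
  exact ⟨((p : ℕ) - (q : ℕ) - (r : ℕ) - (s : ℕ)) / 2, by omega⟩

/-- Integer form of the reduction: modulo `2`, the last two coordinates are the combinations of
the first two prescribed by `A` or `A'`. -/
lemma exists_code_relations {a b : Fin 4 → ℤ} {N : ℤ}
    (h1 : ∑ i, (a i ^ 2 + b i ^ 2) = 4 * N) (h2 : ∑ i, (2 * (a i * b i) + b i ^ 2) = 0) :
    ∃ j l : Fin 4, (j = 2 ∧ l = 3 ∨ j = 3 ∧ l = 2) ∧ ∃ m₁ m₂ m₃ m₄ : ℤ,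
      a j = a 1 + b 1 + b 0 + 2 * m₁ ∧ b j = b 0 + a 1 + a 0 + 2 * m₂ ∧
      a l = a 0 + b 0 + b 1 + 2 * m₃ ∧ b l = a 0 + a 1 + b 1 + 2 * m₄ := by
  choose k p hp using fun i => exists_eq_two_mul_add_fin (a i)
  choose l q hq using fun i => exists_eq_two_mul_add_fin (b i)
  have hA : ∀ i, a i ^ 2 = 4 * (k i ^ 2 + k i * (p i : ℕ)) + (p i : ℕ) := fun i => by
    rw [hp]
    linear_combination fin_two_natCast_sq (p i)
  have hB : ∀ i, b i ^ 2 = 4 * (l i ^ 2 + l i * (q i : ℕ)) + (q i : ℕ) := fun i => by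
    rw [hq]
    linear_combination fin_two_natCast_sq (q i)
  have hAB : ∀ i, 2 * (a i * b i) =
      4 * (2 * k i * l i + k i * (q i : ℕ) + l i * (p i : ℕ)) + 2 * ((p i * q i : ℕ) : ℤ) :=
    fun i => by
      rw [hp, hq]
      push_cast
      ring
  simp only [hA, hB, hAB, Fin.sum_univ_four] at h1 h2
  have hpat := parity_pattern (p 0) (p 1) (p 2) (p 3) (q 0) (q 1) (q 2) (q 3)
    (by omega) (by omega)
  have lift : ∀ {x₁ x₂ x₃ x₄ y₁ y₂ y₃ y₄ : ℤ} {r₁ r₂ r₃ r₄ : Fin 2}, x₁ = 2 * y₁ + (r₁ : ℕ) →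
      x₂ = 2 * y₂ + (r₂ : ℕ) → x₃ = 2 * y₃ + (r₃ : ℕ) → x₄ = 2 * y₄ + (r₄ : ℕ) →
      r₁ = r₂ + r₃ + r₄ → ∃ m : ℤ, x₁ = x₂ + x₃ + x₄ + 2 * m := by
    intro x₁ x₂ x₃ x₄ y₁ y₂ y₃ y₄ r₁ r₂ r₃ r₄ e₁ e₂ e₃ e₄ h
    obtain ⟨m, hm⟩ := exists_eq_add_two_mul_of_fin_eq h
    exact ⟨m + y₁ - y₂ - y₃ - y₄, by linarith⟩
  rcases hpat with ⟨e1, e2, e3, e4⟩ | ⟨e1, e2, e3, e4⟩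
  · obtain ⟨m₁, f₁⟩ := lift (hp 2) (hp 1) (hq 1) (hq 0) e1
    obtain ⟨m₂, f₂⟩ := lift (hq 2) (hq 0) (hp 1) (hp 0) e2
    obtain ⟨m₃, f₃⟩ := lift (hp 3) (hp 0) (hq 0) (hq 1) e3
    obtain ⟨m₄, f₄⟩ := lift (hq 3) (hp 0) (hp 1) (hq 1) e4
    exact ⟨2, 3, .inl ⟨rfl, rfl⟩, m₁, m₂, m₃, m₄, f₁, f₂, f₃, f₄⟩
  · obtain ⟨m₁, f₁⟩ := lift (hp 3) (hp 1) (hq 1) (hq 0) e1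
    obtain ⟨m₂, f₂⟩ := lift (hq 3) (hq 0) (hp 1) (hp 0) e2
    obtain ⟨m₃, f₃⟩ := lift (hp 2) (hp 0) (hq 0) (hq 1) e3
    obtain ⟨m₄, f₄⟩ := lift (hq 2) (hp 0) (hp 1) (hq 1) e4
    exact ⟨3, 2, .inr ⟨rfl, rfl⟩, m₁, m₂, m₃, m₄, f₁, f₂, f₃, f₄⟩

lemma inAmod_or_inAmod_conj {y : Fin 4 → ℝ} (hy : ∀ i, y i ∈ Ztau) {N : ℤ}
    (hs : ∑ i, y i ^ 2 = ((4 * N : ℤ) : ℝ)) : inAmod gr y ∨ inAmod (1 - gr) y := by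
  choose a b hab using hy
  simp only [hab] at hs
  obtain ⟨h1, h2⟩ := sum_sq_eq_intCast_iff.mp hs
  obtain ⟨j, l, hjl, m₁, m₂, m₃, m₄, f₁, f₂, f₃, f₄⟩ := exists_code_relations h1 h2
  have hj : cong2 (y j) (y 0 + (y 1 - y 0) * (1 - gr)) := by
    refine ⟨m₁ + b 1, m₂ + a 1, ?_⟩
    rw [hab j, hab 0, hab 1, f₁, f₂]
    push_cast
    linear_combination ((b 1 : ℝ) - b 0) * gr_sq
  have hl : cong2 (y l) (y 0 + (y 1 - y 0) * gr) := by
    refine ⟨m₃ + b 0, m₄ + a 0, ?_⟩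
    rw [hab l, hab 0, hab 1, f₃, f₄]
    push_cast
    linear_combination ((b 0 : ℝ) - b 1) * gr_sq
  have hy : ∀ i, y i ∈ Ztau := fun i => ⟨a i, b i, hab i⟩
  rcases hjl with ⟨rfl, rfl⟩ | ⟨rfl, rfl⟩
  · exact .inl (inAmod_of_cong2 gr_mem_Ztau hy hj hl)
  · refine .inr (inAmod_of_cong2 conj_gr_mem_Ztau hy ?_ hj)
    rwa [sub_sub_cancel]

lemma mem_sphS_union_iff {n : ℕ} (hn : 1 ≤ n) {x : Fin 4 → ℝ} (hx : ∑ i, x i ^ 2 = 1)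
    (hZ : ∀ i, 2 ^ n * x i ∈ Ztau) :
    x ∈ sphS gr n ∪ sphS (1 - gr) n ↔ ∃ i, ¬ cong2 (2 ^ n * x i) 0 := by
  obtain ⟨k, rfl⟩ := Nat.exists_eq_add_of_le' hn
  constructor
  · rintro (h | h) <;> exact h.2.2.2
  · intro h
    have hs : ∑ i, (2 ^ (k + 1) * x i) ^ 2 = ((4 * 4 ^ k : ℤ) : ℝ) := by
      simp only [mul_pow]
      rw [← Finset.mul_sum, hx, mul_one, pow_right_comm]
      norm_num [pow_succ']
    exact (inAmod_or_inAmod_conj hZ hs).imp (fun hA => ⟨hx, hZ, hA, h⟩)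
      fun hA => ⟨hx, hZ, hA, h⟩

lemma sphS_zero_sum_sq_and_mem {t : ℝ} {x : Fin 4 → ℝ} (h : x ∈ sphS t 0) :
    ∑ i, x i ^ 2 = 1 ∧ ∀ i, x i ∈ Ztau := by
  obtain ⟨i, hi, h0⟩ := h
  constructor
  · rw [Finset.sum_eq_single i (fun j _ hj => by simp [h0 j hj]) (by simp)]
    rcases hi with hi | hi <;> simp [hi]
  · intro j
    by_cases hj : j = i
    · subst hj
      rcases hi with hi | hi <;> rw [hi]
      · simpa using Ztau_intCast 1
      · simpa using Ztau_intCast (-1)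
    · rw [h0 j hj]
      simpa using Ztau_intCast 0

lemma sphS_sum_sq_and_mem {t : ℝ} {m : ℕ} {x : Fin 4 → ℝ} (h : x ∈ sphS t m) :
    ∑ i, x i ^ 2 = 1 ∧ ∀ i, 2 ^ m * x i ∈ Ztau := by
  cases m with
  | zero => simpa using sphS_zero_sum_sq_and_mem h
  | succ m => exact ⟨h.1, h.2.1⟩

lemma mem_sphS_zero_of_mem_Ztau (t : ℝ) {x : Fin 4 → ℝ} (hx : ∑ i, x i ^ 2 = 1)
    (hZ : ∀ i, x i ∈ Ztau) : x ∈ sphS t 0 := by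
  choose a b hab using hZ
  simp only [hab] at hx
  obtain ⟨h1, h2⟩ := sum_sq_eq_intCast_iff (N := 1).mp (by simpa using hx)
  have hnn : ∀ i, 0 ≤ a i ^ 2 + b i ^ 2 := fun i => by positivity
  obtain ⟨i, -, hi⟩ := Finset.exists_ne_zero_of_sum_ne_zero (h1.trans_ne one_ne_zero)
  have hsplit := Finset.add_sum_erase Finset.univ (fun i => a i ^ 2 + b i ^ 2) (Finset.mem_univ i)
  have hrest := Finset.sum_nonneg (s := Finset.univ.erase i) fun j _ => hnn j
  have hpos : 0 < a i ^ 2 + b i ^ 2 := lt_of_le_of_ne (hnn i) (Ne.symm hi)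
  have hzero : ∀ j, j ≠ i → a j = 0 ∧ b j = 0 := by
    intro j hj
    have hj0 := (Finset.sum_eq_zero_iff_of_nonneg fun j _ => hnn j).mp
      (show ∑ j ∈ Finset.univ.erase i, (a j ^ 2 + b j ^ 2) = 0 by linarith) j (by simp [hj])
    constructor <;> nlinarith [sq_nonneg (a j), sq_nonneg (b j)]
  have hi1 : a i ^ 2 + b i ^ 2 = 1 := by linarith
  rw [Finset.sum_eq_single i (fun j _ hj => by simp [hzero j hj]) (by simp)] at h2
  have hbi : b i = 0 := by
    by_contra hne
    have hb1 : 0 < b i ^ 2 := by positivity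
    have ha0 : a i = 0 := by nlinarith [sq_nonneg (a i)]
    simp [ha0, hne] at h2
  have hai : a i = 1 ∨ a i = -1 := sq_eq_one_iff.mp (by simpa [hbi] using hi1)
  refine ⟨i, ?_, fun j hj => by simp [hab j, hzero j hj]⟩
  rcases hai with h | h <;> simp [hab i, hbi, h]

lemma exists_mem_sphS_union (n : ℕ) {x : Fin 4 → ℝ} (hx : ∑ i, x i ^ 2 = 1)
    (hZ : ∀ i, 2 ^ n * x i ∈ Ztau) : ∃ m ≤ n, x ∈ sphS gr m ∪ sphS (1 - gr) m := by
  induction n with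
  | zero => exact ⟨0, le_rfl, .inl (mem_sphS_zero_of_mem_Ztau gr hx (by simpa using hZ))⟩
  | succ n ih =>
    by_cases h : ∃ i, ¬ cong2 (2 ^ (n + 1) * x i) 0
    · exact ⟨n + 1, le_rfl, (mem_sphS_union_iff (by omega) hx hZ).mpr h⟩
    · push Not at h
      obtain ⟨m, hm, hxm⟩ := ih fun i => by
        obtain ⟨a, b, hab⟩ := h i
        refine ⟨a, b, ?_⟩
        rw [pow_succ] at hab
        linarith
      exact ⟨m, by omega, hxm⟩

theorem statement4 (n : ℕ) (hn : 1 ≤ n) :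
    ({x : Fin 4 → ℝ | (∑ i, x i ^ 2) = 1 ∧ ∀ i, 2 ^ n * x i ∈ Ztau}
        = ⋃ m ∈ Set.Iic n, (sphS gr m ∪ sphS (1 - gr) m)) ∧
    (∀ x : Fin 4 → ℝ, (∑ i, x i ^ 2) = 1 → (∀ i, 2 ^ n * x i ∈ Ztau) →
      (x ∈ sphS gr n ∪ sphS (1 - gr) n ↔ ∃ i, ¬ cong2 (2 ^ n * x i) 0)) := by
  refine ⟨?_, fun x => mem_sphS_union_iff hn⟩
  ext x
  simp only [Set.mem_ofPred_eq, Set.mem_iUnion, Set.mem_Iic, exists_prop]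
  constructor
  · rintro ⟨hx, hZ⟩
    exact exists_mem_sphS_union n hx hZ
  · rintro ⟨m, hm, h⟩
    obtain ⟨hx, hZ⟩ := h.elim sphS_sum_sq_and_mem sphS_sum_sq_and_mem
    refine ⟨hx, fun i => ?_⟩
    rw [← Nat.sub_add_cancel hm, pow_add, mul_assoc]
    exact Ztau_mul (two_pow_mem_Ztau _) (hZ i)
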